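/- Let n ≥ 2 and let 𝒜 satisfy (H) for (k,l). For every pairing relation R on E = {e_1, −e_1, …, e_n, −e_n}, the covering Â_R is not invariant under any nontrivial translation of ℝ^n. -/

import Mathlib

namespace Folding

noncomputable section

open Set

/-- Points of `ℝ^n` with the euclidean distance. -/
abbrev Pt (n : ℕ) := EuclideanSpace ℝ (Fin n)

/-- `p` is a point of the lattice `ℤ^n`. -/
def latt {n : ℕ} (p : Pt n) : Prop := ∀ i, ∃ m : ℤ, p i = (m : ℝ)

/-- `p` belongs to `m·ℤ^n`. -/
def inLat {n : ℕ} (m : ℕ) (p : Pt n) : Prop := ∀ i, ∃ c : ℤ, p i = (m : ℝ) * (c : ℝ)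

/-- The canonical basis vector `e_i`. -/
def uvec (n : ℕ) (i : Fin n) : Pt n := EuclideanSpace.single i (1 : ℝ)

/-- `u` belongs to `E = {e_1, -e_1, …, e_n, -e_n}`. -/
def IsDir {n : ℕ} (u : Pt n) : Prop := ∃ i, u = uvec n i ∨ u = -uvec n i

/-- A (nonoriented) lattice segment `[x, x + e_i]`, as an unordered pair of endpoints. -/
def IsSeg {n : ℕ} (S : Sym2 (Pt n)) : Prop := ∃ x i, latt x ∧ S = s(x, x + uvec n i)

/-- A curve: a sequence of segments, indexed by an interval of `ℤ` (finite, ℕ-like or ℤ-like),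
recorded through its sequence of vertices; two consecutive segments have exactly one common
endpoint, and the common endpoints with the preceding and the following segments differ
(`noback`). -/
structure Curve (n : ℕ) where
  dom : Set ℤ
  ordConn : dom.OrdConnected
  nontriv : ∃ i, i ∈ dom ∧ i + 1 ∈ dom
  v : ℤ → Pt n
  lattice : ∀ i ∈ dom, latt (v i)
  step : ∀ i : ℤ, i ∈ dom → i + 1 ∈ dom →
    ∃ j, v (i + 1) = v i + uvec n j ∨ v (i + 1) = v i - uvec n j
  noback : ∀ i : ℤ, i - 1 ∈ dom → i + 1 ∈ dom → v (i + 1) ≠ v (i - 1)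

namespace Curve

variable {n : ℕ} (c : Curve n)

/-- The segments of a curve. -/
def segs : Set (Sym2 (Pt n)) :=
  {S | ∃ i : ℤ, i ∈ c.dom ∧ i + 1 ∈ c.dom ∧ S = s(c.v i, c.v (i + 1))}

/-- The connexions between segments of a curve: pairs of consecutive segments. -/
def conn (S T : Sym2 (Pt n)) : Prop :=
  ∃ i : ℤ, i - 1 ∈ c.dom ∧ i + 1 ∈ c.dom ∧
    ((S = s(c.v (i - 1), c.v i) ∧ T = s(c.v i, c.v (i + 1))) ∨
     (T = s(c.v (i - 1), c.v i) ∧ S = s(c.v i, c.v (i + 1))))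

/-- A curve is self-avoiding if each of its segments appears only once. -/
def SelfAvoiding : Prop :=
  ∀ i j : ℤ, i ∈ c.dom → i + 1 ∈ c.dom → j ∈ c.dom → j + 1 ∈ c.dom →
    s(c.v i, c.v (i + 1)) = s(c.v j, c.v (j + 1)) → i = j

/-- A curve without endpoints (indexed by `ℤ`). -/
def NoEndpts : Prop := c.dom = Set.univ

/-- `p` is an endpoint of the curve `c`. -/
def IsEndpt (p : Pt n) : Prop :=
  ∃ i ∈ c.dom, p = c.v i ∧ (i - 1 ∉ c.dom ∨ i + 1 ∉ c.dom)

/-- `S` is the end segment of `c` at its endpoint `p`. -/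
def endSegAt (p : Pt n) (S : Sym2 (Pt n)) : Prop :=
  ∃ i : ℤ, i ∈ c.dom ∧ p = c.v i ∧
    ((i - 1 ∉ c.dom ∧ i + 1 ∈ c.dom ∧ S = s(c.v i, c.v (i + 1))) ∨
     (i + 1 ∉ c.dom ∧ i - 1 ∈ c.dom ∧ S = s(c.v (i - 1), c.v i)))

/-- The number of segments (length) of a curve. -/
def nsegs : ℕ := {i : ℤ | i ∈ c.dom ∧ i + 1 ∈ c.dom}.ncard

end Curve

/-- The trace of a set of curves: its set of segments together with the connexion
relation between segments.  Two sets of curves are geometrically the same set of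
(nonoriented) curves iff they have the same trace. -/
structure Trace (n : ℕ) where
  segs : Set (Sym2 (Pt n))
  conn : Sym2 (Pt n) → Sym2 (Pt n) → Prop

def curveTrace {n : ℕ} (c : Curve n) : Trace n := ⟨c.segs, c.conn⟩

def traceOf {n : ℕ} (E : Set (Curve n)) : Trace n :=
  ⟨{S | ∃ c ∈ E, S ∈ c.segs}, fun S T => ∃ c ∈ E, c.conn S T⟩

/-- Two curves are the same nonoriented curve. -/
def SameCurve {n : ℕ} (c d : Curve n) : Prop := c.segs = d.segs ∧ c.conn = d.conn

/-- A set of pairwise disjoint self-avoiding curves. -/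
def DisjSA {n : ℕ} (E : Set (Curve n)) : Prop :=
  (∀ c ∈ E, c.SelfAvoiding) ∧
  ∀ c ∈ E, ∀ d ∈ E, ¬ SameCurve c d → ∀ S, S ∈ c.segs → S ∉ d.segs

/-- The set of points of `ℝ^n` lying on the segment `S`. -/
def segPts {n : ℕ} (S : Sym2 (Pt n)) : Set (Pt n) :=
  {p | ∃ a b, S = s(a, b) ∧ ∃ t : ℝ, 0 ≤ t ∧ t ≤ 1 ∧ p = a + t • (b - a)}

def Trace.pts {n : ℕ} (T : Trace n) : Set (Pt n) := ⋃ S ∈ T.segs, segPts S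

/-- A set of curves covers `X ⊆ ℝ^n`: each lattice segment containing a point of `X`
appears in one and only one of the curves. -/
def Covers {n : ℕ} (E : Set (Curve n)) (X : Set (Pt n)) : Prop :=
  ∀ S, IsSeg S → (segPts S ∩ X).Nonempty →
    (∃ c ∈ E, S ∈ c.segs) ∧ ∀ c ∈ E, ∀ d ∈ E, S ∈ c.segs → S ∈ d.segs → SameCurve c d

/-- A covering of `ℝ^n` by disjoint self-avoiding curves. -/
def IsCovering {n : ℕ} (E : Set (Curve n)) : Prop := DisjSA E ∧ Covers E Set.univ

/-- A single curve covers `X`. -/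
def CurveCovers {n : ℕ} (c : Curve n) (X : Set (Pt n)) : Prop :=
  ∀ S, IsSeg S → (segPts S ∩ X).Nonempty → S ∈ c.segs

/-- `b` is a curve contained in the curve `a`. -/
def SubCurve {n : ℕ} (b a : Curve n) : Prop :=
  b.segs ⊆ a.segs ∧ ∀ S T, b.conn S T → a.conn S T

/-- The relation `≺` at the level of traces. -/
def TPrec {n : ℕ} (T T' : Trace n) : Prop :=
  T.segs ⊆ T'.segs ∧ ∀ S S', T.conn S S' → T'.conn S S'

/-- `E ≺ F` : each segment of a curve of `E` is a segment of a curve of `F` and each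
connexion between two segments of a curve of `E` also exists in `F`. -/
def Prec {n : ℕ} (E F : Set (Curve n)) : Prop := TPrec (traceOf E) (traceOf F)

/-- Image of a trace under a map of `ℝ^n`. -/
def Trace.map {n : ℕ} (f : Pt n → Pt n) (T : Trace n) : Trace n :=
  ⟨Sym2.map f '' T.segs,
   fun S S' => ∃ A B, T.conn A B ∧ S = Sym2.map f A ∧ S' = Sym2.map f B⟩

/-- Translation of a trace by the vector `t`. -/
def Trace.transl {n : ℕ} (t : Pt n) (T : Trace n) : Trace n := T.map (fun p => p + t)

/-- Property (H) for the pair `(k, l)`. -/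
def SatH {n : ℕ} (A : Set (Curve n)) (k l : ℕ) : Prop :=
  0 < k ∧ 0 < l ∧ k ∣ l ∧ IsCovering A ∧
  (∀ c ∈ A, c.dom.Finite ∧ ∃ x i, latt x ∧ inLat k x ∧ c.IsEndpt x ∧
      c.IsEndpt (x + (k : ℝ) • uvec n i) ∧
      ∀ p, c.IsEndpt p → p = x ∨ p = x + (k : ℝ) • uvec n i) ∧
  (∀ (x : Pt n) (i : Fin n), latt x → inLat k x →
      (∃ c ∈ A, c.IsEndpt x ∧ c.IsEndpt (x + (k : ℝ) • uvec n i)) ∧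
      ∀ c ∈ A, ∀ d ∈ A, c.IsEndpt x → c.IsEndpt (x + (k : ℝ) • uvec n i) →
        d.IsEndpt x → d.IsEndpt (x + (k : ℝ) • uvec n i) → SameCurve c d) ∧
  (∀ t : Pt n, inLat l t → Trace.transl t (traceOf A) = traceOf A)

/-- The trace of the convolution product `A ∗ B`, where `A` satisfies (H) for `(k, l)`:
apply to `B` the homothety of center `0` and ratio `k`, then replace each resulting
segment by the curve of `A` having the same endpoints (connexions come from the curves
of `A`, together with the junctions of the end segments of consecutive `A`-curves). -/
def ConvTrace {n : ℕ} (k : ℕ) (A B : Set (Curve n)) : Trace n where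
  segs := {S | ∃ a b : Pt n, s(a, b) ∈ (traceOf B).segs ∧
    ∃ c ∈ A, c.IsEndpt ((k : ℝ) • a) ∧ c.IsEndpt ((k : ℝ) • b) ∧ S ∈ c.segs}
  conn := fun S S' =>
    (∃ a b : Pt n, s(a, b) ∈ (traceOf B).segs ∧
      ∃ c ∈ A, c.IsEndpt ((k : ℝ) • a) ∧ c.IsEndpt ((k : ℝ) • b) ∧ c.conn S S') ∨
    (∃ a b d : Pt n, (traceOf B).conn s(a, b) s(b, d) ∧
      ∃ c ∈ A, ∃ c' ∈ A, c.IsEndpt ((k : ℝ) • a) ∧ c.IsEndpt ((k : ℝ) • b) ∧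
        c'.IsEndpt ((k : ℝ) • b) ∧ c'.IsEndpt ((k : ℝ) • d) ∧
        ((c.endSegAt ((k : ℝ) • b) S ∧ c'.endSegAt ((k : ℝ) • b) S') ∨
         (c.endSegAt ((k : ℝ) • b) S' ∧ c'.endSegAt ((k : ℝ) • b) S)))

/-- The two-sided identity of the convolution product: the covering consisting of all
curves with one segment. -/
def unitTrace (n : ℕ) : Trace n := ⟨{S | IsSeg S}, fun _ _ => False⟩

/-- `P s` realizes the power `A^s` for the convolution product. -/
def PowersOf {n : ℕ} (A : Set (Curve n)) (k : ℕ) (P : ℕ → Set (Curve n)) : Prop :=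
  (∀ s, DisjSA (P s)) ∧ traceOf (P 0) = unitTrace n ∧
  ∀ s, traceOf (P (s + 1)) = ConvTrace k A (P s)

/-- The trace of `Â`, the inductive limit of the `A^s` for `≺`. -/
def hatTrace {n : ℕ} (P : ℕ → Set (Curve n)) : Trace n :=
  ⟨{S | ∃ s, S ∈ (traceOf (P s)).segs}, fun S T => ∃ s, (traceOf (P s)).conn S T⟩

/-- A pairing relation on `E = {e_1, -e_1, …, e_n, -e_n}`. -/
def IsPairing {n : ℕ} (R : Pt n → Pt n → Prop) : Prop :=
  (∀ u v, R u v → R v u) ∧ (∀ u v, R u v → IsDir u ∧ IsDir v) ∧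
  (∀ u, ¬ R u u) ∧ ∀ u, IsDir u → ∃! v, R u v

/-- The trace of `Â_R` : `Â` with the segments with endpoint `0` connected according
to `R`. -/
def hatRTrace {n : ℕ} (P : ℕ → Set (Curve n)) (R : Pt n → Pt n → Prop) : Trace n :=
  ⟨(hatTrace P).segs,
   fun S T => (hatTrace P).conn S T ∨
     ∃ u v, R u v ∧ S = s((0 : Pt n), u) ∧ T = s((0 : Pt n), v)⟩

/-- The cube `P_{x,h}`. -/
def cube {n : ℕ} (x : Pt n) (h : ℕ) : Set (Pt n) :=
  {p | ∀ i, x i - h ≤ p i ∧ p i ≤ x i + h}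

/-- Restriction of a trace to a region `X` of `ℝ^n`. -/
def Trace.restr {n : ℕ} (T : Trace n) (X : Set (Pt n)) : Trace n :=
  ⟨{S | S ∈ T.segs ∧ segPts S ⊆ X},
   fun S S' => T.conn S S' ∧ segPts S ⊆ X ∧ segPts S' ⊆ X⟩

/-- Condition (C). -/
def CondC {n : ℕ} (T : Trace n) : Prop :=
  ∀ (x : Pt n) (h : ℕ), latt x → 1 ≤ h →
    ∃ y : Pt n, latt y ∧ y ∉ cube x h ∧
      Trace.transl (y - x) (T.restr (cube x h)) = T.restr (cube y h)

/-- `(B(x,r) ∩ T, x) ≅ (B(y,r) ∩ T', y)` : the translation sending `x` to `y` maps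
the part of `T` in the closed ball `B(x,r)` onto the part of `T'` in `B(y,r)`,
preserving the connexions between segments. -/
def BallIso {n : ℕ} (T : Trace n) (x : Pt n) (T' : Trace n) (y : Pt n) (r : ℝ) : Prop :=
  (fun p => p + (y - x)) '' (T.pts ∩ Metric.closedBall x r) =
      T'.pts ∩ Metric.closedBall y r ∧
  (∀ S S', T.conn S S' → segPts S ⊆ Metric.closedBall x r →
      segPts S' ⊆ Metric.closedBall x r →
      T'.conn (Sym2.map (fun p => p + (y - x)) S) (Sym2.map (fun p => p + (y - x)) S')) ∧
  (∀ S S', T'.conn S S' → segPts S ⊆ Metric.closedBall y r →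
      segPts S' ⊆ Metric.closedBall y r →
      T.conn (Sym2.map (fun p => p + (x - y)) S) (Sym2.map (fun p => p + (x - y)) S'))

/-- The local isomorphism property. -/
def LocIsoProp {n : ℕ} (T : Trace n) : Prop :=
  ∀ (x : Pt n) (r : ℝ), 0 ≤ r →
    ∃ t : ℝ, 0 ≤ t ∧ ∀ y : Pt n, ∃ z ∈ Metric.closedBall y t, BallIso T x T z r

/-- Two traces are locally isomorphic. -/
def LocallyIso {n : ℕ} (T T' : Trace n) : Prop :=
  (∀ (x : Pt n) (r : ℝ), 0 ≤ r → ∃ y, BallIso T x T' y r) ∧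
  (∀ (y : Pt n) (r : ℝ), 0 ≤ r → ∃ x, BallIso T' y T x r)

/-- `Ω_{s,x}` : suppress the connexions between segments whose common endpoint lies in
`x + k^s ℤ^n`. -/
def OmegaTrace {n : ℕ} (k s : ℕ) (x : Pt n) (T : Trace n) : Trace n :=
  ⟨T.segs, fun S S' => T.conn S S' ∧ ¬ ∃ p, p ∈ S ∧ p ∈ S' ∧ inLat (k ^ s) (p - x)⟩

/-- `Σ_{s,x}(E)` : for each curve `D` of `E` passing through `x`, the curve(s) with
endpoint `x` contained in `D` having maximal length, this length being limited to
`8^s`. -/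
def SigmaSet {n : ℕ} (s : ℕ) (x : Pt n) (E : Set (Curve n)) : Set (Curve n) :=
  {b | ∃ D ∈ E, SubCurve b D ∧ b.IsEndpt x ∧ b.nsegs ≤ 8 ^ s ∧
    ∀ b' : Curve n, SubCurve b' D → b'.IsEndpt x → b'.nsegs ≤ 8 ^ s →
      SubCurve b b' → SameCurve b b'}

/-- A positive (orientation preserving) isometry of `ℝ^n`. -/
def PosIsom {n : ℕ} (f : Pt n → Pt n) : Prop :=
  ∃ (g : Pt n ≃ₗᵢ[ℝ] Pt n) (t : Pt n), (∀ x, f x = g x + t) ∧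
    0 < LinearMap.det (g.toLinearEquiv.toLinearMap)

/-- `E` consists of exactly `m` curves. -/
def HasExactly {n : ℕ} (E : Set (Curve n)) (m : ℕ) : Prop :=
  ∃ L : List (Curve n), L.length = m ∧ (∀ c ∈ L, c ∈ E) ∧
    L.Pairwise (fun c d => ¬ SameCurve c d) ∧ ∀ c ∈ E, ∃ d ∈ L, SameCurve c d

/-- `E` consists of at most `m` curves. -/
def AtMost {n : ℕ} (E : Set (Curve n)) (m : ℕ) : Prop :=
  ∃ L : List (Curve n), L.length ≤ m ∧ ∀ c ∈ E, ∃ d ∈ L, SameCurve c d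

/-- The set of points of a curve. -/
def curvePts {n : ℕ} (c : Curve n) : Set (Pt n) := ⋃ S ∈ c.segs, segPts S


/-! ### Graphs of degree at most two with a symmetry -/

theorem exists_path_of_reflTransGen {X : Type*} {G : X → X → Prop} {a b : X}
    (h : Relation.ReflTransGen G a b) :
    ∃ (d : ℕ) (p : ℕ → X), p 0 = a ∧ p d = b ∧ ∀ i < d, G (p i) (p (i + 1)) := by
  induction h with
  | refl => exact ⟨0, fun _ => a, rfl, rfl, by simp⟩
  | @tail b c _ hbc ih =>
    obtain ⟨d, p, h0, hd, hp⟩ := ih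
    refine ⟨d + 1, fun j => if j ≤ d then p j else c, by simp [h0], by simp, ?_⟩
    intro i hi
    rcases Nat.lt_succ_iff_lt_or_eq.1 hi with hi | rfl
    · simpa [hi.le, Nat.succ_le_iff.2 hi] using hp i hi
    · simpa [hd] using hbc

/-- A path `p` of length `d > 0` from `x` to `τ x`, where `τ` preserves `G`, extends to a
`τ`-periodic biinfinite path. -/
theorem exists_periodic_path {X : Type*} {G : X → X → Prop} (τ : Equiv.Perm X)
    (hτ : ∀ a b, G a b ↔ G (τ a) (τ b)) {d : ℕ} (hd : 0 < d) (p : ℕ → X)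
    (hpd : p d = τ (p 0)) (hp : ∀ i < d, G (p i) (p (i + 1))) :
    ∃ q : ℤ → X, q 0 = p 0 ∧ (∀ i, G (q i) (q (i + 1))) ∧ ∀ i, q (i + d) = τ (q i) := by
  have hz : ∀ (m : ℤ) a b, G a b → G ((τ ^ m) a) ((τ ^ m) b) := by
    intro m
    induction m using Int.induction_on with
    | zero => simp
    | succ m ih =>
      intro a b h
      rw [add_comm, zpow_add, zpow_one]
      exact (hτ _ _).1 (ih a b h)
    | pred m ih =>
      intro a b h
      rw [sub_eq_add_neg, add_comm, zpow_add, zpow_neg_one]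
      refine (hτ _ _).2 ?_
      simpa using ih a b h
  have hd' : (0 : ℤ) < d := by exact_mod_cast hd
  refine ⟨fun i => (τ ^ (i / d)) (p (i % d).toNat), by simp, ?_, ?_⟩
  · intro i
    have h0 := Int.emod_nonneg i hd'.ne'
    have h1 := Int.emod_lt_of_pos i hd'
    have h2 := Int.emod_add_mul_ediv i d
    by_cases h : i % d + 1 < d
    · have e1 : (i + 1) / (d : ℤ) = i / d := by
        rw [Int.ediv_eq_iff_of_pos hd']
        constructor <;> nlinarith
      have e2 : (i + 1) % (d : ℤ) = i % d + 1 := by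
        have := Int.emod_add_mul_ediv (i + 1) d
        rw [e1] at this
        linarith
      simp only [e1, e2]
      have : (i % (d : ℤ) + 1).toNat = (i % (d : ℤ)).toNat + 1 := by omega
      rw [this]
      exact hz _ _ _ (hp _ (by omega))
    · have e1 : (i + 1) / (d : ℤ) = i / d + 1 := by
        rw [Int.ediv_eq_iff_of_pos hd']
        constructor <;> nlinarith
      have e2 : (i + 1) % (d : ℤ) = 0 := by
        have := Int.emod_add_mul_ediv (i + 1) d
        rw [e1] at this
        nlinarith
      simp only [e1, e2]
      rw [zpow_add, zpow_one, Equiv.Perm.mul_apply, Int.toNat_zero, ← hpd]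
      have : p d = p ((i % (d : ℤ)).toNat + 1) := congrArg p (by omega)
      rw [this]
      exact hz _ _ _ (hp _ (by omega))
  · intro i
    have e1 : (i + (d : ℤ)) / (d : ℤ) = 1 + i / d := by
      rw [Int.add_ediv_of_dvd_right (dvd_refl _), Int.ediv_self hd'.ne', add_comm]
    simp only [e1, Int.add_emod_right]
    rw [zpow_add, zpow_one, Equiv.Perm.mul_apply]

/-- In a graph of degree at most two, a component which is mapped to itself by an automorphism
acting without fixed points or inversions is finite modulo that automorphism. -/
theorem finite_image_component {X Y : Type*} {G : X → X → Prop} (hsymm : ∀ a b, G a b → G b a)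
    (hdeg : ∀ a b c d, G a b → G a c → G a d → b = c ∨ b = d ∨ c = d)
    (τ : Equiv.Perm X) (hτ : ∀ a b, G a b ↔ G (τ a) (τ b))
    (h1 : ∀ a, τ a ≠ a) (h2 : ∀ a, τ (τ a) ≠ a) {S : X}
    (hS : Relation.ReflTransGen G S (τ S)) (f : X → Y) (hf : ∀ a, f (τ a) = f a) :
    (f '' {T | Relation.ReflTransGen G S T}).Finite := by
  classical
  have hex : ∃ d : ℕ, ∃ p : ℕ → X, Relation.ReflTransGen G S (p 0) ∧ p d = τ (p 0) ∧
      ∀ i < d, G (p i) (p (i + 1)) := by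
    obtain ⟨d, p, h0, hd, hp⟩ := exists_path_of_reflTransGen hS
    exact ⟨d, p, by rw [h0], by rw [hd, h0], hp⟩
  obtain ⟨p, hp0, hpd, hp⟩ := Nat.find_spec hex
  have hmin := fun m => @Nat.find_min _ _ hex m
  generalize Nat.find hex = d at hpd hp hmin
  have hd : 0 < d := by
    rcases Nat.eq_zero_or_pos d with rfl | h
    · exact absurd hpd.symm (h1 _)
    · exact h
  obtain ⟨q, hq0, hq, hqd⟩ := exists_periodic_path τ hτ hd p hpd hp
  have hconn : ∀ i, Relation.ReflTransGen G S (q i) := by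
    intro i
    induction i using Int.induction_on with
    | zero => rwa [hq0]
    | succ i ih => exact ih.tail (hq _)
    | pred i ih =>
      refine ih.tail (hsymm _ _ ?_)
      simpa using hq (-(i : ℤ) - 1)
  have hne : ∀ i, q (i - 1) ≠ q (i + 1) := by
    intro i h
    rcases Nat.lt_or_ge d 2 with h' | h'
    · obtain rfl : d = 1 := by omega
      apply h2 (q (i - 1))
      rw [← hqd, ← hqd, h]
      congr 1
      push_cast
      ring
    · refine hmin (d - 2) (by omega) ⟨fun j => q (i + 1 + j), hconn _, ?_, ?_⟩
      · simp only [Nat.cast_zero, add_zero]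
        rw [← h, ← hqd]
        congr 1
        push_cast [h']
        ring
      · intro j _
        have := hq (i + 1 + j)
        rwa [add_assoc (i + 1), ← Nat.cast_succ] at this
  have hrange : ∀ T, Relation.ReflTransGen G S T → T ∈ range q := by
    have hback : ∀ a b, Relation.ReflTransGen G a b → a ∈ range q → b ∈ range q := by
      intro a b h ha
      induction h with
      | refl => exact ha
      | @tail b c _ hbc ih =>
        obtain ⟨i, rfl⟩ := ih
        have hl : G (q i) (q (i - 1)) := hsymm _ _ (by simpa using hq (i - 1))
        rcases hdeg _ _ _ _ hbc hl (hq i) with h | h | h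
        · exact ⟨_, h.symm⟩
        · exact ⟨_, h.symm⟩
        · exact absurd h (hne i)
    intro T hT
    have hx : Relation.ReflTransGen G (q 0) S := by
      have : Relation.ReflTransGen (fun a b => G b a) (q 0) S :=
        Relation.reflTransGen_swap.2 (hconn 0)
      exact Relation.ReflTransGen.mono (fun a b h => hsymm _ _ h) _ _ this
    exact hback _ _ (hx.trans hT) ⟨0, rfl⟩
  have hper : ∀ (m i : ℤ), f (q (i + m * d)) = f (q i) := by
    intro m
    induction m using Int.induction_on with
    | zero => simp
    | succ m ih =>
      intro i
      rw [add_mul, one_mul, ← add_assoc, hqd, hf, ih]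
    | pred m ih =>
      intro i
      rw [← hf, ← hqd, ← ih i]
      congr 2
      ring
  refine ((finite_Ico (0 : ℤ) d).image fun i => f (q i)).subset ?_
  rintro _ ⟨T, hT, rfl⟩
  obtain ⟨i, rfl⟩ := hrange T hT
  have hd' : (0 : ℤ) < d := by exact_mod_cast hd
  refine ⟨i % d, ⟨Int.emod_nonneg i hd'.ne', Int.emod_lt_of_pos i hd'⟩, ?_⟩
  simp only
  rw [← hper (i / d) (i % d), mul_comm, Int.emod_add_mul_ediv]

/-! ### Segments and curves -/

theorem uvec_ne_zero {n : ℕ} (i : Fin n) : uvec n i ≠ 0 := by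
  simp [uvec]

theorem latt_add {n : ℕ} {p q : Pt n} (hp : latt p) (hq : latt q) : latt (p + q) := by
  intro i
  obtain ⟨a, ha⟩ := hp i
  obtain ⟨b, hb⟩ := hq i
  exact ⟨a + b, by simp [ha, hb]⟩

theorem latt_uvec {n : ℕ} (i : Fin n) : latt (uvec n i) := by
  intro j
  by_cases h : j = i
  · exact ⟨1, by simp [uvec, h]⟩
  · exact ⟨0, by simp [uvec, h]⟩

/-- Two distinct unordered pairs have at most one common element. -/
theorem sym2_common_unique {X : Type*} {S T : Sym2 X} (h : S ≠ T) {a b : X}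
    (haS : a ∈ S) (haT : a ∈ T) (hbS : b ∈ S) (hbT : b ∈ T) : a = b := by
  by_contra hab
  exact h (((Sym2.mem_and_mem_iff hab).1 ⟨haS, hbS⟩).trans
    ((Sym2.mem_and_mem_iff hab).1 ⟨haT, hbT⟩).symm)

namespace Curve

variable {n : ℕ} {c : Curve n}

theorem v_ne {i : ℤ} (h : i ∈ c.dom) (h' : i + 1 ∈ c.dom) : c.v i ≠ c.v (i + 1) := by
  intro e
  obtain ⟨j, hj | hj⟩ := c.step i h h'
  · rw [← e] at hj
    exact uvec_ne_zero j (by simpa using hj)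
  · rw [← e] at hj
    exact uvec_ne_zero j (sub_eq_self.1 hj.symm)

theorem isSeg_of_mem {S : Sym2 (Pt n)} (h : S ∈ c.segs) : IsSeg S := by
  obtain ⟨i, h, h', rfl⟩ := h
  obtain ⟨j, hj | hj⟩ := c.step i h h'
  · exact ⟨c.v i, j, c.lattice _ h, by rw [hj]⟩
  · exact ⟨c.v (i + 1), j, c.lattice _ h', by rw [hj, sub_add_cancel, Sym2.eq_swap]⟩

theorem conn_symm {S T : Sym2 (Pt n)} (h : c.conn S T) : c.conn T S := by
  obtain ⟨i, h1, h2, h⟩ := h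
  exact ⟨i, h1, h2, h.symm⟩

theorem mem_dom_of_between {i j m : ℤ} (hi : i ∈ c.dom) (hm : m ∈ c.dom) (h1 : i ≤ j)
    (h2 : j ≤ m) : j ∈ c.dom :=
  c.ordConn.out hi hm ⟨h1, h2⟩

theorem conn_iff {S T : Sym2 (Pt n)} : c.conn S T ↔
    ∃ i, i ∈ c.dom ∧ i + 1 ∈ c.dom ∧ S = s(c.v i, c.v (i + 1)) ∧
      ((i + 1 + 1 ∈ c.dom ∧ T = s(c.v (i + 1), c.v (i + 1 + 1))) ∨
        (i - 1 ∈ c.dom ∧ T = s(c.v (i - 1), c.v i))) := by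
  constructor
  · rintro ⟨i, h1, h2, ⟨rfl, rfl⟩ | ⟨rfl, rfl⟩⟩
    · have := mem_dom_of_between h1 h2 (j := i) (by omega) (by omega)
      exact ⟨i - 1, h1, by simpa using this, by simp, Or.inl ⟨by simpa using h2, by simp⟩⟩
    · have := mem_dom_of_between h1 h2 (j := i) (by omega) (by omega)
      exact ⟨i, this, h2, rfl, Or.inr ⟨h1, rfl⟩⟩
  · rintro ⟨i, h1, h2, rfl, ⟨h3, rfl⟩ | ⟨h3, rfl⟩⟩
    · exact ⟨i + 1, by simpa using h1, h3, Or.inl ⟨by simp, rfl⟩⟩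
    · exact ⟨i, h3, h2, Or.inr ⟨rfl, rfl⟩⟩

theorem conn_mem_left {S T : Sym2 (Pt n)} (h : c.conn S T) : S ∈ c.segs := by
  obtain ⟨i, h1, h2, rfl, -⟩ := conn_iff.1 h
  exact ⟨i, h1, h2, rfl⟩

theorem conn_mem_right {S T : Sym2 (Pt n)} (h : c.conn S T) : T ∈ c.segs :=
  conn_mem_left (conn_symm h)

theorem conn_ne {S T : Sym2 (Pt n)} (h : c.conn S T) : S ≠ T := by
  have key : ∀ i : ℤ, i - 1 ∈ c.dom → i + 1 ∈ c.dom →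
      s(c.v (i - 1), c.v i) ≠ s(c.v i, c.v (i + 1)) := by
    intro i h1 h2 e
    rw [Sym2.eq_iff] at e
    have h0 := mem_dom_of_between h1 h2 (j := i) (by omega) (by omega)
    rcases e with e | e
    · exact v_ne h0 h2 e.2
    · exact c.noback i h1 h2 e.1.symm
  obtain ⟨i, h1, h2, ⟨rfl, rfl⟩ | ⟨rfl, rfl⟩⟩ := h
  · exact key i h1 h2
  · exact (key i h1 h2).symm

theorem conn_common {S T : Sym2 (Pt n)} (h : c.conn S T) : ∃ b, b ∈ S ∧ b ∈ T := by
  obtain ⟨i, -, -, ⟨rfl, rfl⟩ | ⟨rfl, rfl⟩⟩ := h <;> exact ⟨c.v i, by simp, by simp⟩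

theorem conn_unique (hc : c.SelfAvoiding) {S T T' : Sym2 (Pt n)} (h : c.conn S T)
    (h' : c.conn S T') {b : Pt n} (hS : b ∈ S) (hT : b ∈ T) (hT' : b ∈ T') : T = T' := by
  have hne := conn_ne h
  have hne' := conn_ne h'
  obtain ⟨i, h1, h2, rfl, hT1⟩ := conn_iff.1 h
  obtain ⟨j, h3, h4, e, hT2⟩ := conn_iff.1 h'
  obtain rfl := hc _ _ h1 h2 h3 h4 e
  rcases hT1 with ⟨-, rfl⟩ | ⟨-, rfl⟩ <;> rcases hT2 with ⟨-, rfl⟩ | ⟨-, rfl⟩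
  · rfl
  · have e1 := sym2_common_unique hne hS hT (b := c.v (i + 1)) (by simp) (by simp)
    have e2 := sym2_common_unique hne' hS hT' (b := c.v i) (by simp) (by simp)
    exact absurd (e2.symm.trans e1) (v_ne h1 h2)
  · have e1 := sym2_common_unique hne hS hT (b := c.v i) (by simp) (by simp)
    have e2 := sym2_common_unique hne' hS hT' (b := c.v (i + 1)) (by simp) (by simp)
    exact absurd (e1.symm.trans e2) (v_ne h1 h2)
  · rfl

theorem reflTransGen_conn {S T : Sym2 (Pt n)} (hS : S ∈ c.segs) (hT : T ∈ c.segs) :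
    Relation.ReflTransGen c.conn S T := by
  have key : ∀ (m : ℕ) (i : ℤ), i ∈ c.dom → i + 1 ∈ c.dom → i + m ∈ c.dom → i + m + 1 ∈ c.dom →
      Relation.ReflTransGen c.conn s(c.v i, c.v (i + 1)) s(c.v (i + m), c.v (i + m + 1)) := by
    intro m
    induction m with
    | zero => intro i _ _ _ _; simpa using Relation.ReflTransGen.refl
    | succ m ih =>
      intro i h1 h2 h3 h4
      push_cast at h3 h4 ⊢
      rw [← add_assoc] at h3 h4 ⊢
      have h5 := mem_dom_of_between h1 h3 (j := i + m) (by omega) (by omega)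
      exact (ih i h1 h2 h5 h3).tail (conn_iff.2 ⟨i + m, h5, h3, rfl, Or.inl ⟨h4, rfl⟩⟩)
  obtain ⟨i, h1, h2, rfl⟩ := hS
  obtain ⟨j, h3, h4, rfl⟩ := hT
  rcases le_total i j with h | h
  · obtain ⟨m, rfl⟩ := Int.le.dest h
    exact key m i h1 h2 h3 h4
  · obtain ⟨m, rfl⟩ := Int.le.dest h
    have := Relation.reflTransGen_swap.2 (key m j h3 h4 h1 h2)
    exact Relation.ReflTransGen.mono (fun a b h => conn_symm h) _ _ this

theorem isEndpt_iff {p : Pt n} : c.IsEndpt p ↔ ∃ S, c.endSegAt p S := by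
  constructor
  · rintro ⟨i, hi, rfl, h⟩
    obtain ⟨j, hj, hj'⟩ := c.nontriv
    by_cases h1 : i - 1 ∈ c.dom
    · have h2 := h.resolve_left (not_not.2 h1)
      exact ⟨_, i, hi, rfl, Or.inr ⟨h2, h1, rfl⟩⟩
    · have h2 : i ≤ j := by
        by_contra h2
        exact h1 (mem_dom_of_between hj hi (by omega) (by omega))
      exact ⟨_, i, hi, rfl,
        Or.inl ⟨h1, mem_dom_of_between hi hj' (by omega) (by omega), rfl⟩⟩
  · rintro ⟨S, i, hi, rfl, h | h⟩
    · exact ⟨i, hi, rfl, Or.inl h.1⟩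
    · exact ⟨i, hi, rfl, Or.inr h.1⟩

theorem endSegAt_iff (hc : c.SelfAvoiding) {p : Pt n} {S : Sym2 (Pt n)} :
    c.endSegAt p S ↔ S ∈ c.segs ∧ p ∈ S ∧ ∀ T, c.conn S T → p ∉ T := by
  constructor
  · rintro ⟨i, hi, rfl, ⟨h1, h2, rfl⟩ | ⟨h1, h2, rfl⟩⟩
    · refine ⟨⟨i, hi, h2, rfl⟩, by simp, fun T hT hp => ?_⟩
      have hne := conn_ne hT
      obtain ⟨j, h3, h4, e, h | h⟩ := conn_iff.1 hT
      · obtain rfl := hc _ _ hi h2 h3 h4 e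
        obtain ⟨-, rfl⟩ := h
        exact v_ne hi h2 (sym2_common_unique hne (by simp) hp (by simp) (by simp))
      · obtain rfl := hc _ _ hi h2 h3 h4 e
        exact h1 h.1
    · refine ⟨⟨i - 1, h2, by simpa using hi, by simp⟩, by simp, fun T hT hp => ?_⟩
      have hne := conn_ne hT
      have hi' : i - 1 + 1 ∈ c.dom := by simpa using hi
      obtain ⟨j, h3, h4, e, h | h⟩ := conn_iff.1 hT
      · obtain rfl := hc (i - 1) _ h2 hi' h3 h4 (by simpa using e)
        exact h1 (by simpa using h.1)
      · obtain rfl := hc (i - 1) _ h2 hi' h3 h4 (by simpa using e)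
        obtain ⟨-, rfl⟩ := h
        have := sym2_common_unique hne (by simp) hp (b := c.v (i - 1)) (by simp) (by simp)
        exact v_ne h2 hi' (by simpa using this.symm)
  · rintro ⟨⟨i, h1, h2, rfl⟩, hp, h⟩
    rcases Sym2.mem_iff.1 hp with rfl | rfl
    · refine ⟨i, h1, rfl, Or.inl ⟨fun h3 => ?_, h2, rfl⟩⟩
      exact h _ (conn_iff.2 ⟨i, h1, h2, rfl, Or.inr ⟨h3, rfl⟩⟩) (by simp)
    · refine ⟨i + 1, h2, rfl, Or.inr ⟨fun h3 => ?_, by simpa using h1, by simp⟩⟩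
      exact h _ (conn_iff.2 ⟨i, h1, h2, rfl, Or.inl ⟨h3, rfl⟩⟩) (by simp)

end Curve

theorem SameCurve.endSegAt_iff {n : ℕ} {c d : Curve n} (h : SameCurve c d) (hc : c.SelfAvoiding)
    (hd : d.SelfAvoiding) {p : Pt n} {S : Sym2 (Pt n)} : c.endSegAt p S ↔ d.endSegAt p S := by
  rw [Curve.endSegAt_iff hc, Curve.endSegAt_iff hd, h.1, h.2]

theorem SameCurve.isEndpt_iff {n : ℕ} {c d : Curve n} (h : SameCurve c d) (hc : c.SelfAvoiding)
    (hd : d.SelfAvoiding) {p : Pt n} : c.IsEndpt p ↔ d.IsEndpt p := by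
  simp only [Curve.isEndpt_iff, h.endSegAt_iff hc hd]

theorem DisjSA.sameCurve {n : ℕ} {E : Set (Curve n)} (hE : DisjSA E) {c d : Curve n} (hc : c ∈ E)
    (hd : d ∈ E) {S : Sym2 (Pt n)} (h : S ∈ c.segs) (h' : S ∈ d.segs) : SameCurve c d := by
  by_contra hne
  exact hE.2 c hc d hd hne S h h'

theorem traceOf_conn_symm {n : ℕ} {E : Set (Curve n)} {S T : Sym2 (Pt n)}
    (h : (traceOf E).conn S T) : (traceOf E).conn T S := by
  obtain ⟨c, hc, h⟩ := h
  exact ⟨c, hc, c.conn_symm h⟩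

theorem traceOf_conn_ne {n : ℕ} {E : Set (Curve n)} {S T : Sym2 (Pt n)}
    (h : (traceOf E).conn S T) : S ≠ T := by
  obtain ⟨c, hc, h⟩ := h
  exact c.conn_ne h

theorem traceOf_conn_common {n : ℕ} {E : Set (Curve n)} {S T : Sym2 (Pt n)}
    (h : (traceOf E).conn S T) : ∃ b, b ∈ S ∧ b ∈ T := by
  obtain ⟨c, hc, h⟩ := h
  exact c.conn_common h

theorem DisjSA.conn_unique {n : ℕ} {E : Set (Curve n)} (hE : DisjSA E) {S T T' : Sym2 (Pt n)}
    (h : (traceOf E).conn S T) (h' : (traceOf E).conn S T') {b : Pt n} (hS : b ∈ S) (hT : b ∈ T)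
    (hT' : b ∈ T') : T = T' := by
  obtain ⟨c, hc, h⟩ := h
  obtain ⟨d, hd, h'⟩ := h'
  have hcd := hE.sameCurve hc hd (c.conn_mem_left h) (d.conn_mem_left h')
  rw [← hcd.2] at h'
  exact c.conn_unique (hE.1 c hc) h h' hS hT hT'

/-- A curve of a disjoint set contains every segment connected to one of its segments. -/
theorem DisjSA.mem_segs_of_reflTransGen {n : ℕ} {E : Set (Curve n)} (hE : DisjSA E) {c : Curve n}
    (hc : c ∈ E) {S T : Sym2 (Pt n)} (hS : S ∈ c.segs)
    (h : Relation.ReflTransGen (traceOf E).conn S T) : T ∈ c.segs := by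
  induction h with
  | refl => exact hS
  | tail _ h ih =>
    obtain ⟨d, hd, h⟩ := h
    have hcd := hE.sameCurve hc hd ih (d.conn_mem_left h)
    rw [hcd.1]
    exact d.conn_mem_right h

/-! ### Segments at a vertex of the sublattice -/

/-- The signed basis vectors. -/
def sdir {n : ℕ} (d : Fin n × Bool) : Pt n := if d.2 then uvec n d.1 else -uvec n d.1

theorem sdir_injective {n : ℕ} : Function.Injective (sdir (n := n)) := by
  rintro ⟨i, a⟩ ⟨j, b⟩ h
  have hi := congrArg (fun p : Pt n => p i) h
  by_cases hij : i = j
  · subst hij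
    cases a <;> cases b <;> simp [sdir, uvec] at hi ⊢ <;> norm_num at hi
  · cases a <;> cases b <;> simp [sdir, uvec, hij] at hi

theorem sdir_ne_zero {n : ℕ} (d : Fin n × Bool) : sdir d ≠ 0 := by
  unfold sdir
  split_ifs
  · exact uvec_ne_zero _
  · exact neg_ne_zero.2 (uvec_ne_zero _)

theorem IsSeg.eq_of_mem {n : ℕ} {S : Sym2 (Pt n)} (hS : IsSeg S) {x : Pt n} (hx : x ∈ S) :
    ∃ d, S = s(x, x + sdir d) := by
  obtain ⟨y, i, -, rfl⟩ := hS
  rcases Sym2.mem_iff.1 hx with rfl | rfl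
  · exact ⟨(i, true), by simp [sdir]⟩
  · exact ⟨(i, false), by simp [sdir, Sym2.eq_swap]⟩

theorem IsSeg.latt_of_mem {n : ℕ} {S : Sym2 (Pt n)} (hS : IsSeg S) {x : Pt n} (hx : x ∈ S) :
    latt x := by
  obtain ⟨y, i, hy, rfl⟩ := hS
  rcases Sym2.mem_iff.1 hx with rfl | rfl
  · exact hy
  · exact latt_add hy (latt_uvec i)

theorem inLat.latt {n k : ℕ} {x : Pt n} (h : inLat k x) : latt x := by
  intro i
  obtain ⟨m, hm⟩ := h i
  exact ⟨k * m, by simp [hm]⟩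

theorem inLat_smul {n k : ℕ} {a : Pt n} (h : Folding.latt a) : inLat k ((k : ℝ) • a) := by
  intro i
  obtain ⟨m, hm⟩ := h i
  exact ⟨m, by simp [hm]⟩

theorem inLat.exists_smul {n k : ℕ} {x : Pt n} (h : inLat k x) :
    ∃ a : Pt n, Folding.latt a ∧ x = (k : ℝ) • a := by
  choose m hm using h
  refine ⟨WithLp.toLp 2 fun i => (m i : ℝ), fun i => ⟨m i, rfl⟩, ?_⟩
  ext i
  simp [hm]

theorem inLat_sub {n k : ℕ} {x y : Pt n} (hx : inLat k x) (hy : inLat k y) :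
    inLat k (x - y) := by
  intro i
  obtain ⟨a, ha⟩ := hx i
  obtain ⟨b, hb⟩ := hy i
  exact ⟨a - b, by simp [ha, hb]; ring⟩

theorem SatH.exists_curve_sdir {n k l : ℕ} {A : Set (Curve n)} (hA : SatH A k l) {x : Pt n}
    (hx : inLat k x) (d : Fin n × Bool) :
    ∃ c ∈ A, c.IsEndpt x ∧ c.IsEndpt (x + (k : ℝ) • sdir d) := by
  obtain ⟨-, -, -, -, -, hjoin, -⟩ := hA
  obtain ⟨i, b⟩ := d
  cases b
  · have hy := inLat_sub hx (inLat_smul (k := k) (latt_uvec i))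
    obtain ⟨⟨c, hc, h1, h2⟩, -⟩ := hjoin _ i hy.latt hy
    refine ⟨c, hc, by simpa using h2, ?_⟩
    simpa [sdir, sub_eq_add_neg] using h1
  · obtain ⟨⟨c, hc, h1, h2⟩, -⟩ := hjoin x i hx.latt hx
    exact ⟨c, hc, h1, by simpa [sdir] using h2⟩

/-- Each segment at a point of `kℤ^n` is an end segment of a curve of `A`: there are as many
curves of `A` ending at this point as segments containing it. -/
theorem SatH.exists_endSegAt {n k l : ℕ} {A : Set (Curve n)} (hA : SatH A k l) {x : Pt n}
    (hx : inLat k x) {S : Sym2 (Pt n)} (hS : IsSeg S) (hxS : x ∈ S) :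
    ∃ c ∈ A, c.endSegAt x S := by
  choose c hc h1 h2 using hA.exists_curve_sdir hx
  obtain ⟨hk, -, -, ⟨hdis, -⟩, hend, -, -⟩ := hA
  choose T hT using fun d => Curve.isEndpt_iff.1 (h1 d)
  have hT' := fun d => (Curve.endSegAt_iff (hdis.1 _ (hc d))).1 (hT d)
  choose g hg using fun d => (Curve.isSeg_of_mem (hT' d).1).eq_of_mem (hT' d).2.1
  have hk' : (k : ℝ) ≠ 0 := by exact_mod_cast hk.ne'
  have hne : ∀ d, x + (k : ℝ) • sdir d ≠ x := fun d h =>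
    smul_ne_zero hk' (sdir_ne_zero d) (by simpa using h)
  have hinj : Function.Injective g := by
    intro d d' h
    have hTT : T d = T d' := by rw [hg, hg, h]
    have hmem := (hT' d').1
    rw [← hTT] at hmem
    have hsame := hdis.sameCurve (hc d) (hc d') (hT' d).1 hmem
    have h3 := (hsame.isEndpt_iff (hdis.1 _ (hc d)) (hdis.1 _ (hc d'))).2 (h2 d')
    obtain ⟨-, y, i, -, -, -, -, hy⟩ := hend _ (hc d)
    have key : x + (k : ℝ) • sdir d = x + (k : ℝ) • sdir d' := by
      have n1 := hne d
      have n2 := hne d'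
      rcases hy _ (h1 d) with e1 | e1 <;> rcases hy _ (h2 d) with e2 | e2 <;>
        rcases hy _ h3 with e3 | e3
      · exact absurd (e2.trans e1.symm) n1
      · exact absurd (e2.trans e1.symm) n1
      · exact absurd (e3.trans e1.symm) n2
      · exact e2.trans e3.symm
      · exact e2.trans e3.symm
      · exact absurd (e3.trans e1.symm) n2
      · exact absurd (e2.trans e1.symm) n1
      · exact absurd (e2.trans e1.symm) n1
    exact sdir_injective (smul_right_injective _ hk' (add_left_cancel key))
  obtain ⟨d, rfl⟩ := hS.eq_of_mem hxS
  obtain ⟨d', rfl⟩ := (Finite.injective_iff_surjective.1 hinj) d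
  exact ⟨c d', hc d', by rw [← hg]; exact hT d'⟩

/-- The curves of `A` do not pass through the points of `kℤ^n`. -/
theorem SatH.not_conn_at {n k l : ℕ} {A : Set (Curve n)} (hA : SatH A k l) {x : Pt n}
    (hx : inLat k x) {c : Curve n} (hc : c ∈ A) {S T : Sym2 (Pt n)} (h : c.conn S T)
    (hS : x ∈ S) (hT : x ∈ T) : False := by
  obtain ⟨d, hd, hdS⟩ := hA.exists_endSegAt hx (c.isSeg_of_mem (c.conn_mem_left h)) hS
  obtain ⟨-, -, -, ⟨hdis, -⟩, -⟩ := hA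
  have hdS' := (Curve.endSegAt_iff (hdis.1 _ hd)).1 hdS
  have hsame := hdis.sameCurve hc hd (c.conn_mem_left h) hdS'.1
  exact hdS'.2.2 T (hsame.2 ▸ h) hT

/-! ### Substitution -/

/-- `S` is a segment of a curve of `A` whose endpoints are those of `k U`. -/
def IsChild {n : ℕ} (A : Set (Curve n)) (k : ℕ) (S U : Sym2 (Pt n)) : Prop :=
  ∃ a b : Pt n, U = s(a, b) ∧ ∃ c ∈ A, c.IsEndpt ((k : ℝ) • a) ∧ c.IsEndpt ((k : ℝ) • b) ∧
    S ∈ c.segs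

theorem IsSeg.segPts_nonempty {n : ℕ} {S : Sym2 (Pt n)} (hS : IsSeg S) :
    (segPts S ∩ univ).Nonempty := by
  obtain ⟨x, i, -, rfl⟩ := hS
  exact ⟨x, ⟨x, _, rfl, 0, le_rfl, zero_le_one, by simp⟩, trivial⟩

theorem SatH.exists_mem_segs {n k l : ℕ} {A : Set (Curve n)} (hA : SatH A k l)
    {S : Sym2 (Pt n)} (hS : IsSeg S) : ∃ c ∈ A, S ∈ c.segs :=
  (hA.2.2.2.1.2 S hS hS.segPts_nonempty).1

theorem SatH.exists_isChild {n k l : ℕ} {A : Set (Curve n)} (hA : SatH A k l)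
    {S : Sym2 (Pt n)} (hS : IsSeg S) : ∃ U, IsSeg U ∧ IsChild A k S U := by
  obtain ⟨c, hc, hSc⟩ := hA.exists_mem_segs hS
  obtain ⟨-, x, i, -, hx, h1, h2, -⟩ := hA.2.2.2.2.1 c hc
  obtain ⟨a, ha, rfl⟩ := hx.exists_smul
  exact ⟨_, ⟨a, i, ha, rfl⟩, a, _, rfl, c, hc, h1, by rwa [smul_add], hSc⟩

theorem SatH.exists_curve {n k l : ℕ} {A : Set (Curve n)} (hA : SatH A k l)
    {a b : Pt n} (hU : IsSeg s(a, b)) :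
    ∃ c ∈ A, c.IsEndpt ((k : ℝ) • a) ∧ c.IsEndpt ((k : ℝ) • b) := by
  obtain ⟨x, i, hx, e⟩ := hU
  have hx' := inLat_smul (k := k) hx
  obtain ⟨⟨c, hc, h1, h2⟩, -⟩ := hA.2.2.2.2.2.1 _ i hx'.latt hx'
  rw [← smul_add] at h2
  rcases Sym2.eq_iff.1 e with ⟨rfl, rfl⟩ | ⟨rfl, rfl⟩
  · exact ⟨c, hc, h1, h2⟩
  · exact ⟨c, hc, h2, h1⟩

theorem SatH.sameCurve_of_endpt {n k l : ℕ} {A : Set (Curve n)} (hA : SatH A k l)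
    {a b a' b' : Pt n} (hU : IsSeg s(a, b)) (e : s(a, b) = s(a', b')) {c d : Curve n}
    (hc : c ∈ A) (hd : d ∈ A) (h1 : c.IsEndpt ((k : ℝ) • a)) (h2 : c.IsEndpt ((k : ℝ) • b))
    (h3 : d.IsEndpt ((k : ℝ) • a')) (h4 : d.IsEndpt ((k : ℝ) • b')) : SameCurve c d := by
  obtain ⟨x, i, hx, e'⟩ := hU
  have hx' := inLat_smul (k := k) hx
  have key : ∀ c : Curve n, ∀ p q : Pt n, s(p, q) = s(x, x + uvec n i) →
      c.IsEndpt ((k : ℝ) • p) → c.IsEndpt ((k : ℝ) • q) →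
      c.IsEndpt ((k : ℝ) • x) ∧ c.IsEndpt ((k : ℝ) • x + (k : ℝ) • uvec n i) := by
    intro c p q e h1 h2
    rw [← smul_add]
    rcases Sym2.eq_iff.1 e with ⟨rfl, rfl⟩ | ⟨rfl, rfl⟩
    · exact ⟨h1, h2⟩
    · exact ⟨h2, h1⟩
  obtain ⟨c1, c2⟩ := key c a b e' h1 h2
  obtain ⟨d1, d2⟩ := key d a' b' (e.symm.trans e') h3 h4
  exact (hA.2.2.2.2.2.1 _ i hx'.latt hx').2 c hc d hd c1 c2 d1 d2

/-! ### Powers -/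

theorem PowersOf.segs_eq {n k l : ℕ} {A : Set (Curve n)} (hA : SatH A k l)
    {P : ℕ → Set (Curve n)} (hP : PowersOf A k P) (s : ℕ) :
    (traceOf (P s)).segs = {S | IsSeg S} := by
  induction s with
  | zero => rw [hP.2.1]; rfl
  | succ s ih =>
    apply Subset.antisymm
    · rintro S ⟨c, -, h⟩
      exact c.isSeg_of_mem h
    · intro S hS
      rw [hP.2.2 s]
      obtain ⟨U, hU, a, b, rfl, h⟩ := hA.exists_isChild hS
      exact ⟨a, b, by rw [ih]; exact hU, h⟩

theorem ConvTrace_conn_mono {n k : ℕ} {A B B' : Set (Curve n)}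
    (hsegs : (traceOf B).segs ⊆ (traceOf B').segs)
    (hconn : ∀ S T, (traceOf B).conn S T → (traceOf B').conn S T) {S T : Sym2 (Pt n)}
    (h : (ConvTrace k A B).conn S T) : (ConvTrace k A B').conn S T := by
  rcases h with ⟨a, b, h, h'⟩ | ⟨a, b, d, h, h'⟩
  · exact Or.inl ⟨a, b, hsegs h, h'⟩
  · exact Or.inr ⟨a, b, d, hconn _ _ h, h'⟩

theorem PowersOf.conn_succ {n k l : ℕ} {A : Set (Curve n)} (hA : SatH A k l)
    {P : ℕ → Set (Curve n)} (hP : PowersOf A k P) (s : ℕ) :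
    ∀ S T, (traceOf (P s)).conn S T → (traceOf (P (s + 1))).conn S T := by
  induction s with
  | zero =>
    intro S T h
    rw [hP.2.1] at h
    exact h.elim
  | succ s ih =>
    intro S T h
    rw [hP.2.2] at h ⊢
    exact ConvTrace_conn_mono (by rw [hP.segs_eq hA, hP.segs_eq hA]) ih h

theorem PowersOf.conn_mono {n k l : ℕ} {A : Set (Curve n)} (hA : SatH A k l)
    {P : ℕ → Set (Curve n)} (hP : PowersOf A k P) {s s' : ℕ} (hs : s ≤ s')
    {S T : Sym2 (Pt n)} (h : (traceOf (P s)).conn S T) : (traceOf (P s')).conn S T := by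
  induction s', hs using Nat.le_induction with
  | base => exact h
  | succ m _ ih => exact hP.conn_succ hA m _ _ ih

/-- The powers of `A` have no connexion at the origin. -/
theorem PowersOf.not_conn_zero {n k l : ℕ} {A : Set (Curve n)} (hA : SatH A k l)
    {P : ℕ → Set (Curve n)} (hP : PowersOf A k P) (s : ℕ) :
    ∀ S T, (traceOf (P s)).conn S T → (0 : Pt n) ∈ S → (0 : Pt n) ∈ T → False := by
  induction s with
  | zero =>
    intro S T h
    rw [hP.2.1] at h
    exact h.elim
  | succ s ih =>
    intro S T h hS hT
    have hne := traceOf_conn_ne h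
    rw [hP.2.2] at h
    rcases h with ⟨a, b, -, c, hc, -, -, h⟩ | ⟨a, b, d, h, c, hc, c', hc', -, -, -, -, h'⟩
    · exact hA.not_conn_at (x := 0) (fun i => ⟨0, by simp⟩) hc h hS hT
    · have hsa := hA.2.2.2.1.1.1
      have hb : (k : ℝ) • b ≠ 0 := by
        refine smul_ne_zero (by exact_mod_cast hA.1.ne') ?_
        rintro rfl
        exact ih _ _ h (by simp) (by simp)
      refine hb ?_
      rcases h' with ⟨h1, h2⟩ | ⟨h1, h2⟩
      · rw [Curve.endSegAt_iff (hsa _ hc)] at h1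
        rw [Curve.endSegAt_iff (hsa _ hc')] at h2
        exact sym2_common_unique hne h1.2.1 h2.2.1 hS hT
      · rw [Curve.endSegAt_iff (hsa _ hc)] at h1
        rw [Curve.endSegAt_iff (hsa _ hc')] at h2
        exact sym2_common_unique hne h2.2.1 h1.2.1 hS hT

/-- For `k = 1` the powers of `A` have no connexion. -/
theorem PowersOf.not_conn_of_eq_one {n l : ℕ} {A : Set (Curve n)} (hA : SatH A 1 l)
    {P : ℕ → Set (Curve n)} (hP : PowersOf A 1 P) (s : ℕ) :
    ∀ S T, ¬ (traceOf (P s)).conn S T := by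
  induction s with
  | zero =>
    intro S T h
    rw [hP.2.1] at h
    exact h.elim
  | succ s ih =>
    intro S T h
    rw [hP.2.2] at h
    rcases h with ⟨a, b, -, c, hc, -, -, h⟩ | ⟨a, b, d, h, -⟩
    · obtain ⟨x, hS, hT⟩ := c.conn_common h
      have hx := (c.isSeg_of_mem (c.conn_mem_left h)).latt_of_mem hS
      exact hA.not_conn_at (by simpa using inLat_smul (k := 1) hx) hc h hS hT
    · exact ih _ _ h

/-- Segments with the same parent, or with connected parents, are connected. -/
theorem PowersOf.reflTransGen_succ {n k l : ℕ} {A : Set (Curve n)} (hA : SatH A k l)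
    {P : ℕ → Set (Curve n)} (hP : PowersOf A k P) {s : ℕ} {U U' : Sym2 (Pt n)} (hU : IsSeg U)
    (h : Relation.ReflTransGen (traceOf (P s)).conn U U') :
    ∀ S S', IsChild A k S U → IsChild A k S' U' →
      Relation.ReflTransGen (traceOf (P (s + 1))).conn S S' := by
  have hdis := hA.2.2.2.1.1
  have inner : ∀ a b, IsSeg s(a, b) → ∀ c ∈ A, c.IsEndpt ((k : ℝ) • a) →
      c.IsEndpt ((k : ℝ) • b) → ∀ S ∈ c.segs, ∀ S' ∈ c.segs,
      Relation.ReflTransGen (traceOf (P (s + 1))).conn S S' := by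
    intro a b hab c hc h1 h2 S hS S' hS'
    refine Relation.ReflTransGen.mono (fun T T' hT => ?_) _ _ (c.reflTransGen_conn hS hS')
    rw [hP.2.2]
    exact Or.inl ⟨a, b, by rw [hP.segs_eq hA]; exact hab, c, hc, h1, h2, hT⟩
  induction h with
  | refl =>
    rintro S S' ⟨a, b, rfl, c, hc, h1, h2, hS⟩ ⟨a', b', e, c', hc', h3, h4, hS'⟩
    have hsame := hA.sameCurve_of_endpt hU e hc hc' h1 h2 h3 h4
    exact inner a b hU c hc h1 h2 S hS S' (hsame.1 ▸ hS')
  | @tail V W _ hVW ih =>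
    rintro S S' hS ⟨a', b', e, c', hc', h3, h4, hS'⟩
    have hV : IsSeg V := by
      obtain ⟨c, -, h⟩ := hVW
      exact c.isSeg_of_mem (c.conn_mem_left h)
    have hW : IsSeg W := by
      obtain ⟨c, -, h⟩ := hVW
      exact c.isSeg_of_mem (c.conn_mem_right h)
    obtain ⟨y, hyV, hyW⟩ := traceOf_conn_common hVW
    obtain ⟨a, rfl⟩ := Sym2.mem_iff_exists.1 hyV
    obtain ⟨d, rfl⟩ := Sym2.mem_iff_exists.1 hyW
    obtain ⟨c, hc, h1, h2⟩ := hA.exists_curve hV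
    obtain ⟨f, hf, h5, h6⟩ := hA.exists_curve hW
    obtain ⟨T, hT⟩ := Curve.isEndpt_iff.1 h1
    obtain ⟨T', hT'⟩ := Curve.isEndpt_iff.1 h5
    have hTs := ((Curve.endSegAt_iff (hdis.1 _ hc)).1 hT).1
    have hTs' := ((Curve.endSegAt_iff (hdis.1 _ hf)).1 hT').1
    refine (ih S T hS ⟨y, a, rfl, c, hc, h1, h2, hTs⟩).trans ?_
    have hsame := hA.sameCurve_of_endpt hW e hf hc' h5 h6 h3 h4
    refine Relation.ReflTransGen.head ?_
      (inner y d hW f hf h5 h6 T' hTs' S' (hsame.1 ▸ hS'))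
    rw [hP.2.2]
    exact Or.inr ⟨a, y, d, by rwa [Sym2.eq_swap (a := a)], c, hc, f, hf, h2, h1, h5, h6,
      Or.inl ⟨hT, hT'⟩⟩

/-! ### Finiteness and contraction -/

theorem finite_latt (n : ℕ) (r : ℝ) : {x : Pt n | latt x ∧ ∀ j, |x j| ≤ r}.Finite := by
  refine ((finite_Icc (fun _ : Fin n => -⌈r⌉) (fun _ => ⌈r⌉)).image
    fun m => (WithLp.toLp 2 fun i => (m i : ℝ) : Pt n)).subset ?_
  rintro x ⟨hx, hr⟩
  choose m hm using hx
  refine ⟨m, ⟨fun j => ?_, fun j => ?_⟩, ?_⟩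
  · have h1 := (abs_le.1 (hr j)).1
    have h2 := Int.le_ceil r
    rw [hm] at h1
    have h3 : ((-⌈r⌉ : ℤ) : ℝ) ≤ (m j : ℝ) := by push_cast; linarith
    exact_mod_cast h3
  · have h1 := (abs_le.1 (hr j)).2
    have h2 := Int.le_ceil r
    rw [hm] at h1
    have h3 : (m j : ℝ) ≤ (⌈r⌉ : ℝ) := by linarith
    exact_mod_cast h3
  · ext j
    simp [hm]

theorem finite_seg (n : ℕ) (r : ℝ) :
    {S : Sym2 (Pt n) | ∃ x i, latt x ∧ (∀ j, |x j| ≤ r) ∧ S = s(x, x + uvec n i)}.Finite := by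
  refine (((finite_latt n r).prod (finite_univ (α := Fin n))).image
    fun q => s(q.1, q.1 + uvec n q.2)).subset ?_
  rintro S ⟨x, i, hx, hr, rfl⟩
  exact ⟨(x, i), ⟨⟨hx, hr⟩, trivial⟩, rfl⟩

theorem finite_seg_norm (n : ℕ) (r : ℝ) :
    {S : Sym2 (Pt n) | IsSeg S ∧ ∀ p ∈ S, ‖p‖ ≤ r}.Finite := by
  refine (finite_seg n r).subset ?_
  rintro S ⟨⟨x, i, hx, rfl⟩, h⟩
  refine ⟨x, i, hx, fun j => ?_, rfl⟩
  exact (PiLp.norm_apply_le x j).trans (h x (by simp))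

theorem Trace.conn_map_of_transl {n : ℕ} {T : Trace n} {t : Pt n} (h : Trace.transl t T = T)
    {S S' : Sym2 (Pt n)} (hS : T.conn S S') :
    T.conn (Sym2.map (fun p => p + t) S) (Sym2.map (fun p => p + t) S') := by
  rw [← h]
  exact ⟨S, S', hS, rfl, rfl⟩

/-- Each segment lies at bounded distance from `k U`, where `U` is its parent. -/
theorem SatH.exists_bound {n k l : ℕ} {A : Set (Curve n)} (hA : SatH A k l) :
    ∃ C : ℝ, 0 ≤ C ∧ ∀ S U, IsSeg S → IsChild A k S U → ∀ p ∈ S, ∀ a ∈ U,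
      ‖(k : ℝ) • a - p‖ ≤ C := by
  have hdis := hA.2.2.2.1.1
  have hl : (0 : ℤ) < l := by exact_mod_cast hA.2.1
  have hper := hA.2.2.2.2.2.2
  have hfin := fun c hc => (hA.2.2.2.2.1 c hc).1
  have hex : ∀ S : Sym2 (Pt n), IsSeg S → ∃ c ∈ A, S ∈ c.segs := fun S => hA.exists_mem_segs
  rcases isEmpty_or_nonempty (Curve n) with hemp | hne
  · refine ⟨0, le_rfl, ?_⟩
    rintro S U - ⟨-, -, -, d, -⟩
    exact hemp.elim d
  choose! c hc hSc using hex
  set B := {S : Sym2 (Pt n) | ∃ x i, latt x ∧ (∀ j, |x j| ≤ (l : ℝ)) ∧ S = s(x, x + uvec n i)}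
  have hBseg : ∀ S ∈ B, IsSeg S := by
    rintro S ⟨x, i, hx, -, rfl⟩
    exact ⟨x, i, hx, rfl⟩
  have hV : (⋃ S ∈ B, (c S).v '' (c S).dom).Finite :=
    (finite_seg n l).biUnion fun S hS => (hfin _ (hc S (hBseg S hS))).image _
  obtain ⟨C, hC⟩ := (Metric.isBounded_iff.1 hV.isBounded)
  refine ⟨max C 0, le_max_right _ _, ?_⟩
  rintro S U ⟨x, i, hx, rfl⟩ ⟨a, b, rfl, d, hd, h1, h2, hS⟩
  have hmemV : ∀ S0 ∈ B, ∀ T ∈ (c S0).segs, ∀ p ∈ T, p ∈ ⋃ S ∈ B, (c S).v '' (c S).dom := by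
    rintro S0 hS0 T ⟨i, hi, hi', rfl⟩ p hp
    refine mem_biUnion hS0 ?_
    rcases Sym2.mem_iff.1 hp with rfl | rfl
    · exact ⟨_, hi, rfl⟩
    · exact ⟨_, hi', rfl⟩
  choose m hm using hx
  let w : Pt n := WithLp.toLp 2 fun j => (l : ℝ) * ((m j / (l : ℤ) : ℤ) : ℝ)
  have hw : inLat l (-w) := fun j => ⟨-(m j / (l : ℤ)), by simp [w]⟩
  have hcoord : ∀ j, (x + -w) j = ((m j % (l : ℤ) : ℤ) : ℝ) := by
    intro j
    have h := Int.emod_add_mul_ediv (m j) l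
    have h' : ((m j % (l : ℤ) : ℤ) : ℝ) + (l : ℝ) * ((m j / (l : ℤ) : ℤ) : ℝ) = m j := by
      exact_mod_cast h
    simp only [PiLp.add_apply, PiLp.neg_apply, hm, w]
    linarith
  have hS0 : s(x + -w, x + -w + uvec n i) ∈ B := by
    refine ⟨_, i, fun j => ⟨_, hcoord j⟩, fun j => ?_, rfl⟩
    have h1 := Int.emod_nonneg (m j) hl.ne'
    have h2 := (Int.emod_lt_of_pos (m j) hl).le
    rw [hcoord, abs_of_nonneg (Int.cast_nonneg h1), ← Int.cast_natCast]
    exact Int.cast_le.2 h2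
  have hmap : Sym2.map (fun p => p + -w) s(x, x + uvec n i) =
      s(x + -w, x + -w + uvec n i) := by
    rw [Sym2.map_mk, add_right_comm]
  have key : ∀ T ∈ d.segs, ∀ p ∈ T, p + -w ∈ ⋃ S ∈ B, (c S).v '' (c S).dom := by
    intro T hT p hp
    have h : Relation.ReflTransGen (traceOf A).conn
        (Sym2.map (fun p => p + -w) s(x, x + uvec n i)) (Sym2.map (fun p => p + -w) T) :=
      Relation.ReflTransGen.lift _
        (fun S S' h => Trace.conn_map_of_transl (hper _ hw) ⟨d, hd, h⟩) _ _
        (d.reflTransGen_conn hS hT)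
    rw [hmap] at h
    refine hmemV _ hS0 _ (hdis.mem_segs_of_reflTransGen (hc _ (hBseg _ hS0))
      (hSc _ (hBseg _ hS0)) h) _ ?_
    exact Sym2.mem_map.2 ⟨p, hp, rfl⟩
  have hend : ∀ y, d.IsEndpt y → y + -w ∈ ⋃ S ∈ B, (c S).v '' (c S).dom := by
    intro y hy
    obtain ⟨T, hT⟩ := Curve.isEndpt_iff.1 hy
    have hT' := (Curve.endSegAt_iff (hdis.1 _ hd)).1 hT
    exact key T hT'.1 y hT'.2.1
  intro p hp y hy
  have h3 := hend _ (show d.IsEndpt ((k : ℝ) • y) by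
    rcases Sym2.mem_iff.1 hy with rfl | rfl
    · exact h1
    · exact h2)
  have h4 := hC h3 (key _ hS p hp)
  rw [dist_add_right, dist_eq_norm] at h4
  exact h4.trans (le_max_left _ _)

/-- `T` is the ancestor of order `s` of `S`. -/
def IsAncestor {n : ℕ} (A : Set (Curve n)) (k : ℕ) : ℕ → Sym2 (Pt n) → Sym2 (Pt n) → Prop
  | 0, S, T => S = T
  | s + 1, S, T => ∃ U, IsSeg U ∧ IsChild A k S U ∧ IsAncestor A k s U T

theorem PowersOf.reflTransGen_of_isAncestor {n k l : ℕ} {A : Set (Curve n)} (hA : SatH A k l)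
    {P : ℕ → Set (Curve n)} (hP : PowersOf A k P) (s : ℕ) :
    ∀ S S' T, IsAncestor A k s S T → IsAncestor A k s S' T →
      Relation.ReflTransGen (traceOf (P s)).conn S S' := by
  induction s with
  | zero =>
    rintro S S' T rfl rfl
    exact Relation.ReflTransGen.refl
  | succ s ih =>
    rintro S S' T ⟨U, hU, h1, h2⟩ ⟨U', -, h1', h2'⟩
    exact hP.reflTransGen_succ hA hU (ih U U' T h2 h2') S S' h1 h1'

theorem SatH.exists_isAncestor {n k l : ℕ} {A : Set (Curve n)} (hA : SatH A k l) (hk : 2 ≤ k)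
    {C : ℝ} (hC0 : 0 ≤ C)
    (hC : ∀ S U, IsSeg S → IsChild A k S U → ∀ p ∈ S, ∀ a ∈ U, ‖(k : ℝ) • a - p‖ ≤ C) (s : ℕ) :
    ∀ (ρ : ℝ) (S : Sym2 (Pt n)), 0 ≤ ρ → IsSeg S → (∀ p ∈ S, ‖p‖ ≤ C + ρ) →
      ∃ T, IsAncestor A k s S T ∧ IsSeg T ∧ ∀ p ∈ T, ‖p‖ ≤ C + ρ / 2 ^ s := by
  induction s with
  | zero =>
    intro ρ S _ hS h
    exact ⟨S, rfl, hS, by simpa using h⟩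
  | succ s ih =>
    intro ρ S hρ hS h
    obtain ⟨U, hU, hSU⟩ := hA.exists_isChild hS
    obtain ⟨T, hT, hT', hn⟩ := ih (ρ / 2) U (by positivity) hU (by
      intro a ha
      obtain ⟨p, hp⟩ : ∃ p, p ∈ S := by
        obtain ⟨x, i, -, rfl⟩ := hS
        exact ⟨x, by simp⟩
      have h1 := hC S U hS hSU p hp a ha
      have h2 := h p hp
      have h3 : ‖(k : ℝ) • a‖ ≤ ‖(k : ℝ) • a - p‖ + ‖p‖ := by
        simpa using norm_add_le ((k : ℝ) • a - p) p
      rw [norm_smul, Real.norm_natCast] at h3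
      have h4 : (2 : ℝ) ≤ k := by exact_mod_cast hk
      nlinarith [norm_nonneg a])
    refine ⟨T, ⟨U, hU, hSU, hT⟩, hT', fun p hp => (hn p hp).trans_eq ?_⟩
    rw [pow_succ]
    field_simp

/-- For `k ≥ 2`, there are finitely many classes of segments modulo connectedness in `Â`. -/
theorem PowersOf.exists_finite_classes {n k l : ℕ} {A : Set (Curve n)} (hA : SatH A k l)
    (hk : 2 ≤ k) {P : ℕ → Set (Curve n)} (hP : PowersOf A k P) :
    ∃ (F : Set (Sym2 (Pt n))) (g : Sym2 (Pt n) → Sym2 (Pt n)), F.Finite ∧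
      (∀ S, IsSeg S → g S ∈ F) ∧ ∀ S S', IsSeg S → IsSeg S' → g S = g S' →
        Relation.ReflTransGen (hatTrace P).conn S S' := by
  obtain ⟨C, hC0, hC⟩ := hA.exists_bound
  let F := {S : Sym2 (Pt n) | IsSeg S ∧ ∀ p ∈ S, ‖p‖ ≤ C + 1}
  have hF : F.Finite := finite_seg_norm n (C + 1)
  have hlim : ∀ S, IsSeg S → ∃ T ∈ F, ∀ᶠ s in (Filter.hyperfilter ℕ : Filter ℕ),
      IsAncestor A k s S T := by
    intro S hS
    rw [← Ultrafilter.eventually_exists_mem_iff hF]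
    refine Filter.Eventually.filter_mono Nat.hyperfilter_le_atTop ?_
    obtain ⟨ρ, hρ0, hρ⟩ : ∃ ρ : ℝ, 0 ≤ ρ ∧ ∀ p ∈ S, ‖p‖ ≤ C + ρ := by
      obtain ⟨x, i, -, rfl⟩ := hS
      refine ⟨‖x‖ + ‖x + uvec n i‖, by positivity, fun p hp => ?_⟩
      have h1 := norm_nonneg x
      have h2 := norm_nonneg (x + uvec n i)
      rcases Sym2.mem_iff.1 hp with rfl | rfl <;> linarith
    have htend : Filter.Tendsto (fun s : ℕ => ρ / 2 ^ s) Filter.atTop (nhds 0) :=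
      tendsto_const_nhds.div_atTop (tendsto_pow_atTop_atTop_of_one_lt one_lt_two)
    filter_upwards [htend.eventually_le_const one_pos] with s hs
    obtain ⟨T, h1, h2, h3⟩ := hA.exists_isAncestor hk hC0 hC s ρ S hρ0 hS hρ
    exact ⟨T, ⟨h2, fun p hp => (h3 p hp).trans (by linarith)⟩, h1⟩
  choose! g hgF hg using hlim
  refine ⟨F, g, hF, hgF, fun S S' hS hS' e => ?_⟩
  obtain ⟨s, h1, h2⟩ := ((hg S hS).and (hg S' hS')).exists
  rw [← e] at h2
  exact Relation.ReflTransGen.mono (fun T T' h => ⟨s, h⟩) _ _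
    (hP.reflTransGen_of_isAncestor hA s S S' _ h1 h2)

/-! ### The covering `Â_R` -/

theorem hatRTrace_segs {n k l : ℕ} {A : Set (Curve n)} (hA : SatH A k l)
    {P : ℕ → Set (Curve n)} (hP : PowersOf A k P) (R : Pt n → Pt n → Prop) :
    (hatRTrace P R).segs = {S | IsSeg S} := by
  ext S
  simp [hatRTrace, hatTrace, hP.segs_eq hA]

theorem hatRTrace_conn_symm {n : ℕ} {P : ℕ → Set (Curve n)} {R : Pt n → Pt n → Prop}
    (hR : IsPairing R) (S T : Sym2 (Pt n)) (h : (hatRTrace P R).conn S T) :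
    (hatRTrace P R).conn T S := by
  rcases h with ⟨s, h⟩ | ⟨u, v, h, rfl, rfl⟩
  · exact Or.inl ⟨s, traceOf_conn_symm h⟩
  · exact Or.inr ⟨v, u, hR.1 _ _ h, rfl, rfl⟩

theorem hatRTrace_conn_common {n : ℕ} {P : ℕ → Set (Curve n)} {R : Pt n → Pt n → Prop}
    {S T : Sym2 (Pt n)} (h : (hatRTrace P R).conn S T) : ∃ b, b ∈ S ∧ b ∈ T := by
  rcases h with ⟨s, h⟩ | ⟨u, v, h, rfl, rfl⟩
  · exact traceOf_conn_common h
  · exact ⟨0, by simp, by simp⟩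

theorem IsPairing.seg_ne {n : ℕ} {R : Pt n → Pt n → Prop} (hR : IsPairing R) {u v : Pt n}
    (h : R u v) : s((0 : Pt n), u) ≠ s((0 : Pt n), v) := by
  intro e
  obtain rfl := Sym2.congr_right.1 e
  exact hR.2.2.1 _ h

theorem hatRTrace_conn_unique {n k l : ℕ} {A : Set (Curve n)} (hA : SatH A k l)
    {P : ℕ → Set (Curve n)} (hP : PowersOf A k P) {R : Pt n → Pt n → Prop} (hR : IsPairing R)
    {S T T' : Sym2 (Pt n)} (h : (hatRTrace P R).conn S T) (h' : (hatRTrace P R).conn S T')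
    {b : Pt n} (hS : b ∈ S) (hT : b ∈ T) (hT' : b ∈ T') : T = T' := by
  have cross : ∀ {s : ℕ} {T : Sym2 (Pt n)} {u v : Pt n}, R u v →
      (traceOf (P s)).conn s(0, u) T → b ∈ s(0, u) → b ∈ s(0, v) → b ∈ T → False := by
    intro s T u v huv h h1 h2 h3
    obtain rfl := sym2_common_unique (hR.seg_ne huv) h1 h2 (b := 0) (by simp) (by simp)
    exact hP.not_conn_zero hA s _ _ h h1 h3
  rcases h with ⟨s, h⟩ | ⟨u, v, h, rfl, rfl⟩ <;> rcases h' with ⟨s', h'⟩ | ⟨u', v', h', e, rfl⟩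
  · exact (hP.1 (max s s')).conn_unique (hP.conn_mono hA (le_max_left _ _) h)
      (hP.conn_mono hA (le_max_right _ _) h') hS hT hT'
  · subst e
    exact (cross h' h hS hT' hT).elim
  · exact (cross h h' hS hT hT').elim
  · obtain rfl := Sym2.congr_right.1 e
    rw [(hR.2.2.2 u (hR.2.1 _ _ h).1).unique h h']

theorem hatRTrace_conn_degree {n k l : ℕ} {A : Set (Curve n)} (hA : SatH A k l)
    {P : ℕ → Set (Curve n)} (hP : PowersOf A k P) {R : Pt n → Pt n → Prop} (hR : IsPairing R)
    (S T₁ T₂ T₃ : Sym2 (Pt n)) (h₁ : (hatRTrace P R).conn S T₁) (h₂ : (hatRTrace P R).conn S T₂)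
    (h₃ : (hatRTrace P R).conn S T₃) : T₁ = T₂ ∨ T₁ = T₃ ∨ T₂ = T₃ := by
  obtain ⟨b₁, hS₁, hb₁⟩ := hatRTrace_conn_common h₁
  obtain ⟨b₂, hS₂, hb₂⟩ := hatRTrace_conn_common h₂
  obtain ⟨b₃, hS₃, hb₃⟩ := hatRTrace_conn_common h₃
  have hb : b₁ = b₂ ∨ b₁ = b₃ ∨ b₂ = b₃ := by
    induction S with | _ x y
    rw [Sym2.mem_iff] at hS₁ hS₂ hS₃
    grind
  rcases hb with rfl | rfl | rfl
  · exact Or.inl (hatRTrace_conn_unique hA hP hR h₁ h₂ hS₁ hb₁ hb₂)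
  · exact Or.inr (Or.inl (hatRTrace_conn_unique hA hP hR h₁ h₃ hS₁ hb₁ hb₃))
  · exact Or.inr (Or.inr (hatRTrace_conn_unique hA hP hR h₂ h₃ hS₂ hb₂ hb₃))

/-- Translation of segments. -/
def segTransl {n : ℕ} (t : Pt n) : Equiv.Perm (Sym2 (Pt n)) where
  toFun := Sym2.map (fun p => p + t)
  invFun := Sym2.map (fun p => p - t)
  left_inv S := by induction S with | _ x y => simp
  right_inv S := by induction S with | _ x y => simp

theorem segTransl_mk {n : ℕ} (t a b : Pt n) : segTransl t s(a, b) = s(a + t, b + t) := rfl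

theorem segTransl_pow {n : ℕ} (t : Pt n) (m : ℕ) : segTransl t ^ m = segTransl (m • t) := by
  ext1 S
  induction m with
  | zero => induction S with | _ x y => simp [segTransl_mk]
  | succ m ih =>
    rw [pow_succ', Equiv.Perm.mul_apply, ih]
    induction S with | _ x y => simp [segTransl_mk, succ_nsmul, add_assoc]

theorem nsmul_ne_zero_pt {n m : ℕ} (hm : m ≠ 0) {t : Pt n} (ht : t ≠ 0) : m • t ≠ 0 := by
  rw [← Nat.cast_smul_eq_nsmul ℝ]
  exact smul_ne_zero (by exact_mod_cast hm) ht

theorem segTransl_ne {n : ℕ} {t : Pt n} (ht : t ≠ 0) (S : Sym2 (Pt n)) : segTransl t S ≠ S := by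
  induction S with | _ x y
  rw [segTransl_mk]
  intro e
  rcases Sym2.eq_iff.1 e with ⟨h, -⟩ | ⟨h1, h2⟩
  · exact ht (by simpa using h)
  · rw [← h1, add_assoc] at h2
    have h3 : t + t = 0 := by simpa using h2
    rw [← two_smul ℝ] at h3
    exact ht ((smul_eq_zero.1 h3).resolve_left two_ne_zero)

theorem Trace.conn_segTransl_iff {n : ℕ} {T : Trace n} {t : Pt n} (h : Trace.transl t T = T)
    (S S' : Sym2 (Pt n)) : T.conn S S' ↔ T.conn (segTransl t S) (segTransl t S') := by
  refine ⟨Trace.conn_map_of_transl h, fun hS => ?_⟩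
  rw [← h] at hS
  obtain ⟨U, U', hU, e, e'⟩ := hS
  rwa [(segTransl t).injective e, (segTransl t).injective e']

theorem Trace.conn_segTransl_pow_iff {n : ℕ} {T : Trace n} {t : Pt n}
    (h : Trace.transl t T = T) (m : ℕ) : ∀ S S' : Sym2 (Pt n),
    T.conn S S' ↔ T.conn ((segTransl t ^ m) S) ((segTransl t ^ m) S') := by
  induction m with
  | zero => simp
  | succ m ih =>
    intro S S'
    rw [pow_succ', Equiv.Perm.mul_apply, Equiv.Perm.mul_apply, ← Trace.conn_segTransl_iff h]
    exact ih S S'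

/-- If `Â_R` is invariant under the translation by `t`, then each component is mapped to itself
by the translation by a positive multiple of `t`. -/
theorem exists_pow_mem_component {n k l : ℕ} {A : Set (Curve n)} (hA : SatH A k l)
    (hk : 2 ≤ k) {P : ℕ → Set (Curve n)} (hP : PowersOf A k P) {R : Pt n → Pt n → Prop}
    {t : Pt n} (h : Trace.transl t (hatRTrace P R) = hatRTrace P R) {S : Sym2 (Pt n)}
    (hS : IsSeg S) : ∃ m : ℕ, 0 < m ∧
      Relation.ReflTransGen (hatRTrace P R).conn S ((segTransl t ^ m) S) := by
  obtain ⟨F, g, hF, hgF, hg⟩ := hP.exists_finite_classes hA hk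
  have hseg : ∀ m : ℕ, IsSeg ((segTransl t ^ m) S) := by
    intro m
    induction m with
    | zero => exact hS
    | succ m ih =>
      have e := hatRTrace_segs hA hP R
      have : (segTransl t ^ (m + 1)) S ∈ (Trace.transl t (hatRTrace P R)).segs := by
        refine ⟨(segTransl t ^ m) S, by rw [e]; exact ih, ?_⟩
        rw [pow_succ', Equiv.Perm.mul_apply]
        rfl
      rw [h, e] at this
      exact this
  obtain ⟨m, m', hlt, e⟩ := hF.exists_lt_map_eq_of_forall_mem
    (f := fun m : ℕ => g ((segTransl t ^ m) S)) fun m => hgF _ (hseg m)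
  refine ⟨m' - m, by omega, ?_⟩
  have h1 : Relation.ReflTransGen (hatRTrace P R).conn ((segTransl t ^ m) S)
      ((segTransl t ^ m') S) :=
    Relation.ReflTransGen.mono (fun _ _ h => Or.inl h) _ _ (hg _ _ (hseg m) (hseg m') e)
  have h2 : Relation.ReflTransGen (hatRTrace P R).conn
      ((segTransl t ^ m).symm ((segTransl t ^ m) S))
      ((segTransl t ^ m).symm ((segTransl t ^ m') S)) :=
    Relation.ReflTransGen.lift (p := (hatRTrace P R).conn) (segTransl t ^ m).symm
    (fun a b hab => by
      change (hatRTrace P R).conn ((segTransl t ^ m).symm a) ((segTransl t ^ m).symm b)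
      rw [Trace.conn_segTransl_pow_iff h m]
      simpa using hab) _ _ h1
  have h3 : (segTransl t ^ m') S = (segTransl t ^ m) ((segTransl t ^ (m' - m)) S) := by
    rw [← Equiv.Perm.mul_apply, ← pow_add, Nat.add_sub_cancel' hlt.le]
  rwa [h3, Equiv.symm_apply_apply, Equiv.symm_apply_apply] at h2

/-- A `t`-invariant function takes finitely many values on the segments if `Â_R` is invariant
under the translation by `t`. -/
theorem finite_image_seg {n k l : ℕ} {A : Set (Curve n)} (hA : SatH A k l)
    (hk : 2 ≤ k) {P : ℕ → Set (Curve n)} (hP : PowersOf A k P) {R : Pt n → Pt n → Prop}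
    (hR : IsPairing R) {t : Pt n} (ht : t ≠ 0)
    (h : Trace.transl t (hatRTrace P R) = hatRTrace P R) {Y : Type*} (f : Sym2 (Pt n) → Y)
    (hf : ∀ S, f (segTransl t S) = f S) : (f '' {S | IsSeg S}).Finite := by
  obtain ⟨F, g, hF, hgF, hg⟩ := hP.exists_finite_classes hA hk
  refine (hF.biUnion (t := fun T => f '' {S | IsSeg S ∧ g S = T}) fun T _ => ?_).subset ?_
  · rcases {S | IsSeg S ∧ g S = T}.eq_empty_or_nonempty with hE | ⟨S, hS, rfl⟩
    · rw [hE, image_empty]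
      exact finite_empty
    · obtain ⟨m, hm, hSm⟩ := exists_pow_mem_component hA hk hP h hS
      have hmt : m • t ≠ 0 := nsmul_ne_zero_pt hm.ne' ht
      have hfm : ∀ (m : ℕ) S, f ((segTransl t ^ m) S) = f S := by
        intro m S
        induction m with
        | zero => rfl
        | succ m ih => rw [pow_succ', Equiv.Perm.mul_apply, hf, ih]
      refine (finite_image_component (hatRTrace_conn_symm hR) (hatRTrace_conn_degree hA hP hR)
        (segTransl t ^ m) (Trace.conn_segTransl_pow_iff h m) ?_ ?_ hSm f (hfm m)).subset ?_
      · intro S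
        rw [segTransl_pow]
        exact segTransl_ne hmt S
      · intro S
        rw [← Equiv.Perm.mul_apply, ← pow_add, segTransl_pow]
        exact segTransl_ne (nsmul_ne_zero_pt (by omega) ht) S
      · refine image_mono ?_
        rintro S' ⟨hS', e⟩
        exact Relation.ReflTransGen.mono (fun _ _ h => Or.inl h) _ _ (hg _ _ hS hS' e.symm)
  · rintro _ ⟨S, hS, rfl⟩
    exact mem_biUnion (hgF S hS) ⟨S, ⟨hS, rfl⟩, rfl⟩

theorem transl_ne_of_two_le {n k l : ℕ} (hn : 2 ≤ n) {A : Set (Curve n)} (hA : SatH A k l)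
    (hk : 2 ≤ k) {P : ℕ → Set (Curve n)} (hP : PowersOf A k P) {R : Pt n → Pt n → Prop}
    (hR : IsPairing R) {t : Pt n} (ht : t ≠ 0) :
    Trace.transl t (hatRTrace P R) ≠ hatRTrace P R := by
  intro h
  obtain ⟨i, hi⟩ : ∃ i, t i ≠ 0 := by
    by_contra! hz
    exact ht (by ext i; simpa using hz i)
  have : Nontrivial (Fin n) := Fin.nontrivial_iff_two_le.2 hn
  obtain ⟨j, hj⟩ := exists_ne i
  let φ : Pt n → ℝ := fun p => t i * p j - t j * p i
  have hφ : ∀ p, φ (p + t) = φ p := by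
    intro p
    simp only [φ, PiLp.add_apply]
    ring
  have hfin := finite_image_seg hA hk hP hR ht h (Sym2.map φ) (by
    intro S
    induction S with | _ x y
    rw [segTransl_mk, Sym2.map_mk, Sym2.map_mk, hφ, hφ])
  let σ : ℕ → Sym2 (Pt n) := fun m => s((m : ℝ) • uvec n j, (m : ℝ) • uvec n j + uvec n j)
  have hσ : ∀ m, Sym2.map φ (σ m) = s(t i * m, t i * (m + 1)) := by
    intro m
    simp only [σ, Sym2.map_mk, φ, uvec, PiLp.add_apply, PiLp.smul_apply,
      PiLp.single_apply, hj.symm]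
    simp
  refine infinite_of_injective_forall_mem (f := fun m => Sym2.map φ (σ m)) ?_ (fun m => ?_) hfin
  · intro m m' e
    simp only [hσ] at e
    rcases Sym2.eq_iff.1 e with ⟨e, -⟩ | ⟨e1, e2⟩
    · exact Nat.cast_injective (mul_left_cancel₀ hi e)
    · have e1 := mul_left_cancel₀ hi e1
      have e2 := mul_left_cancel₀ hi e2
      linarith
  · refine ⟨_, ⟨_, j, fun r => ?_, rfl⟩, rfl⟩
    obtain ⟨c, hc⟩ := latt_uvec j r
    exact ⟨m * c, by simp [hc]⟩

theorem transl_ne_of_eq_one {n l : ℕ} (hn : 2 ≤ n) {A : Set (Curve n)} (hA : SatH A 1 l)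
    {P : ℕ → Set (Curve n)} (hP : PowersOf A 1 P) {R : Pt n → Pt n → Prop}
    (hR : IsPairing R) {t : Pt n} (ht : t ≠ 0) :
    Trace.transl t (hatRTrace P R) ≠ hatRTrace P R := by
  intro h
  obtain ⟨v, hv, -⟩ := hR.2.2.2 (uvec n ⟨0, by omega⟩) ⟨_, Or.inl rfl⟩
  have hconn : (hatRTrace P R).conn s(0, uvec n ⟨0, by omega⟩) s(0, v) :=
    Or.inr ⟨_, _, hv, rfl, rfl⟩
  rcases (Trace.conn_segTransl_iff h _ _).1 hconn with ⟨s, h'⟩ | ⟨u', v', -, e, e'⟩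
  · exact hP.not_conn_of_eq_one hA s _ _ h'
  · have hne := (segTransl t).injective.ne (hR.seg_ne hv)
    refine ht (sym2_common_unique hne (a := t) (b := 0) (by simp [segTransl_mk])
      (by simp [segTransl_mk]) (by rw [e]; simp) (by rw [e']; simp))

/-- Proposition 1.2: no `Â_R` is invariant through a nontrivial
translation. -/
theorem statement5 {n : ℕ} (hn : 2 ≤ n) (A : Set (Curve n)) (k l : ℕ)
    (hA : SatH A k l) (P : ℕ → Set (Curve n)) (hP : PowersOf A k P)
    (R : Pt n → Pt n → Prop) (hR : IsPairing R) :
    ∀ t : Pt n, t ≠ 0 → Trace.transl t (hatRTrace P R) ≠ hatRTrace P R := by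
  intro t ht
  rcases (Nat.one_le_iff_ne_zero.2 hA.1.ne').eq_or_lt with rfl | hk
  · exact transl_ne_of_eq_one hn hA hP hR ht
  · exact transl_ne_of_two_le hn hA hk hP hR ht

end
end Folding
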